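/- arXiv:1711.11198 — 2 statements merged into one kernel-verified Lean document; each statement's English description precedes it below -/
import Mathlib

section
/- Let n ≥ 2 and suppose α, β ∈ ℝ satisfy β ≥ 0, 0 < α + β < n − β, (n − α − 2β)/(2n) + (n − α)/(2(n − 1)) < 1, and in addition α < 1. If f(y) = c (d² + |y − y₀|²)^{−(n+α−2)/2} with c ≥ 0, d > 0, y₀ ∈ ∂ℝ₊ⁿ, then for every x' ∈ ℝ^{n−1}, lim_{x_n → 0⁺} x_n^{1−α−β} E_{α,β}f(x', x_n) = C_{n,α} f(x'), where C_{n,α} = ∫_{ℝ^{n−1}} (1 + |y|²)^{(α−n)/2} dy. -/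
open MeasureTheory Real Filter Metric

noncomputable section

/-- Boundary of the upper half space: `ℝ^{n-1}`. -/
abbrev Bd (n : ℕ) := EuclideanSpace ℝ (Fin (n - 1))

/-- Points of `ℝ^{n-1} × ℝ`; the upper half space is the set where the last coordinate
is positive. -/
abbrev Hs (n : ℕ) := EuclideanSpace ℝ (Fin (n - 1)) × ℝ

/-- The (open) upper half space. -/
def upperHalf (n : ℕ) : Set (Hs n) := {x | 0 < x.2}

/-- Lebesgue measure restricted to the upper half space. -/
def hsMeasure (n : ℕ) : Measure (Hs n) := volume.restrict (upperHalf n)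

/-- `|x - y| ^ (α - n)` for `x` in the (closed) upper half space and `y` on its boundary. -/
def kern (n : ℕ) (α : ℝ) (x : Hs n) (y : Bd n) : ℝ :=
  Real.sqrt (‖x.1 - y‖ ^ 2 + x.2 ^ 2) ^ (α - (n : ℝ))

/-- The extension operator `E_{α,β} f (x) = ∫_{∂ℝⁿ₊} xₙ^β f(y) |x - y|^{α-n} dy`. -/
def extOp (n : ℕ) (α β : ℝ) (f : Bd n → ℝ) (x : Hs n) : ℝ :=
  ∫ y : Bd n, x.2 ^ β * f y * kern n α x y

/-- The restriction operator `R_{α,β} g (y) = ∫_{ℝⁿ₊} xₙ^β g(x) |x - y|^{α-n} dx`. -/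
def resOp (n : ℕ) (α β : ℝ) (g : Hs n → ℝ) (y : Bd n) : ℝ :=
  ∫ x in upperHalf n, x.2 ^ β * g x * kern n α x y

/-- `L^p`-norm (for a real exponent `p`) of a real valued function. -/
def lpN {X : Type*} [MeasurableSpace X] (μ : Measure X) (p : ℝ) (f : X → ℝ) : ℝ :=
  (∫ x, |f x| ^ p ∂μ) ^ (1 / p)

/-- The unit ball of `ℝⁿ`. -/
def unitBall (n : ℕ) : Set (EuclideanSpace ℝ (Fin n)) := Metric.ball 0 1

/-- The surface measure on the unit sphere `∂B ⊆ ℝⁿ`. -/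
def sphMeas (n : ℕ) : Measure (Metric.sphere (0 : EuclideanSpace ℝ (Fin n)) 1) :=
  (volume : Measure (EuclideanSpace ℝ (Fin n))).toSphere

/-- The kernel `H(ξ, ζ) = ((1 - |ξ|²)/2)^β |ξ - ζ|^{α-n}` on `B × ∂B`. -/
def Hk (n : ℕ) (α β : ℝ) (ξ ζ : EuclideanSpace ℝ (Fin n)) : ℝ :=
  ((1 - ‖ξ‖ ^ 2) / 2) ^ β * ‖ξ - ζ‖ ^ (α - (n : ℝ))

/-- The sharp constant
`C_e(n,α,β) = (n ω_n)^{-(n+α-2)/(2(n-1))} ‖∫_{∂B} H(·,ζ) dS_ζ‖_{L^{2n/(n-α-2β)}(B)}`. -/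
def Ce (n : ℕ) (α β : ℝ) : ℝ :=
  ((n : ℝ) * (volume (unitBall n)).toReal) ^ (-((n : ℝ) + α - 2) / (2 * ((n : ℝ) - 1))) *
    lpN (volume.restrict (unitBall n)) (2 * (n : ℝ) / ((n : ℝ) - α - 2 * β))
      (fun ξ => ∫ ζ, Hk n α β ξ ↑ζ ∂sphMeas n)

/-- An at most polynomially growing power of the squared distance, integrated against the
Poisson-type kernel, is dominated by an integrable function uniformly for small dilations. -/
theorem exists_integrable_bound_dilated_power {m : ℕ} {d p q : ℝ} (hd : 0 < d)
    (hp : (m : ℝ) < -2 * p) (hpq : (m : ℝ) < -2 * (p + q)) (x y₀ : EuclideanSpace ℝ (Fin m)) :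
    ∃ g : EuclideanSpace ℝ (Fin m) → ℝ, Integrable g ∧ ∀ t ∈ Set.Ioo (0 : ℝ) 1, ∀ u,
      (d ^ 2 + ‖x - t • u - y₀‖ ^ 2) ^ q * (1 + ‖u‖ ^ 2) ^ p ≤ g u := by
  have hint : ∀ r : ℝ, (m : ℝ) < -2 * r →
      Integrable (fun u : EuclideanSpace ℝ (Fin m) => (1 + ‖u‖ ^ 2) ^ r) := fun r hr => by
    have := integrable_rpow_neg_one_add_norm_sq (E := EuclideanSpace ℝ (Fin m)) (μ := volume)
      (r := -2 * r) (by simpa using hr)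
    rwa [show -(-2 * r) / 2 = r by ring] at this
  have hd2 : 0 < d ^ 2 := by positivity
  rcases le_or_gt q 0 with hq | hq
  · refine ⟨fun u => (d ^ 2) ^ q * (1 + ‖u‖ ^ 2) ^ p, (hint p hp).const_mul _, fun t _ u => ?_⟩
    refine mul_le_mul_of_nonneg_right ?_ (by positivity)
    exact rpow_le_rpow_of_nonpos hd2 (le_add_of_nonneg_right (by positivity)) hq
  · refine ⟨fun u => (d ^ 2 + 2 * ‖x - y₀‖ ^ 2 + 2) ^ q * (1 + ‖u‖ ^ 2) ^ (p + q),
      (hint _ hpq).const_mul _, fun t ht u => ?_⟩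
    have hnorm : ‖x - t • u - y₀‖ ≤ ‖x - y₀‖ + ‖u‖ := by
      rw [sub_right_comm]
      refine (norm_sub_le _ _).trans (add_le_add_right ?_ _)
      rw [norm_smul, Real.norm_eq_abs, abs_of_pos ht.1]
      exact mul_le_of_le_one_left (norm_nonneg u) ht.2.le
    have hsq : ‖x - t • u - y₀‖ ^ 2 ≤ 2 * ‖x - y₀‖ ^ 2 + 2 * ‖u‖ ^ 2 := by
      nlinarith [sq_nonneg (‖x - y₀‖ - ‖u‖), norm_nonneg (x - t • u - y₀)]
    have hbase : d ^ 2 + ‖x - t • u - y₀‖ ^ 2 ≤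
        (d ^ 2 + 2 * ‖x - y₀‖ ^ 2 + 2) * (1 + ‖u‖ ^ 2) := by
      have h : 0 ≤ (d ^ 2 + 2 * ‖x - y₀‖ ^ 2) * ‖u‖ ^ 2 := by positivity
      linarith
    calc (d ^ 2 + ‖x - t • u - y₀‖ ^ 2) ^ q * (1 + ‖u‖ ^ 2) ^ p
        ≤ ((d ^ 2 + 2 * ‖x - y₀‖ ^ 2 + 2) * (1 + ‖u‖ ^ 2)) ^ q * (1 + ‖u‖ ^ 2) ^ p := by
          refine mul_le_mul_of_nonneg_right ?_ (by positivity)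
          exact rpow_le_rpow (by positivity) hbase hq.le
      _ = (d ^ 2 + 2 * ‖x - y₀‖ ^ 2 + 2) ^ q * (1 + ‖u‖ ^ 2) ^ (p + q) := by
          rw [mul_rpow (by positivity) (by positivity), rpow_add (by positivity)]
          ring

/-- Rescaling the extension operator to unit height. -/
theorem rpow_mul_extOp_eq_integral {n : ℕ} (hn : 1 ≤ n) (α β : ℝ) (f : Bd n → ℝ) (x : Bd n)
    {t : ℝ} (ht : 0 < t) :
    t ^ (1 - α - β) * extOp n α β f (x, t) =
      ∫ u : Bd n, f (x - t • u) * (1 + ‖u‖ ^ 2) ^ ((α - (n : ℝ)) / 2) := by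
  have hker : ∀ u : Bd n, kern n α (x, t) (x - t • u) =
      t ^ (α - (n : ℝ)) * (1 + ‖u‖ ^ 2) ^ ((α - (n : ℝ)) / 2) := fun u => by
    have h : ‖x - (x - t • u)‖ ^ 2 + t ^ 2 = t ^ 2 * (1 + ‖u‖ ^ 2) := by
      rw [sub_sub_cancel, norm_smul, Real.norm_eq_abs, mul_pow, sq_abs]
      ring
    rw [kern, h, Real.sqrt_mul (by positivity), Real.sqrt_sq ht.le,
      mul_rpow ht.le (Real.sqrt_nonneg _), Real.sqrt_eq_rpow, ← rpow_mul (by positivity)]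
    ring_nf
  have hscale : extOp n α β f (x, t) =
      t ^ (n - 1) * ∫ u : Bd n, t ^ β * f (x - t • u) * kern n α (x, t) (x - t • u) := by
    have h := Measure.integral_comp_smul (volume : Measure (Bd n))
      (fun v => t ^ β * f (x - v) * kern n α (x, t) (x - v)) t
    rw [h, integral_sub_left_eq_self (fun y => t ^ β * f y * kern n α (x, t) y) volume x,
      finrank_euclideanSpace_fin, abs_of_pos (by positivity), smul_eq_mul, ← mul_assoc,
      mul_inv_cancel₀ (by positivity), one_mul, extOp]
  rw [hscale, ← mul_assoc, ← integral_const_mul]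
  refine integral_congr_ae (Eventually.of_forall fun u => ?_)
  have hpow : t ^ (1 - α - β) * t ^ (n - 1) * t ^ β * t ^ (α - (n : ℝ)) = 1 := by
    rw [← rpow_natCast, ← rpow_add ht, ← rpow_add ht, ← rpow_add ht, Nat.cast_sub hn]
    convert rpow_zero t using 2
    push_cast
    ring
  simp only [hker]
  linear_combination (f (x - t • u) * (1 + ‖u‖ ^ 2) ^ ((α - (n : ℝ)) / 2)) * hpow

/-- **Boundary behaviour of the extension of the extremal functions, case `α < 1`**:
for `f(y) = c (d² + |y - y₀|²)^{-(n+α-2)/2}` one has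
`lim_{xₙ → 0⁺} xₙ^{1-α-β} E_{α,β}f(x', xₙ) = C_{n,α} f(x')` for every `x' ∈ ∂ℝⁿ₊`,
where `C_{n,α} = ∫_{ℝ^{n-1}} (1 + |y|²)^{(α-n)/2} dy`. -/
theorem extension_boundary_limit_alpha_lt_one
    (n : ℕ) (hn : 2 ≤ n) (α β : ℝ)
    (hβ : 0 ≤ β) (hαβ : 0 < α + β) (hαβn : α + β < (n : ℝ) - β)
    (hsub : ((n : ℝ) - α - 2 * β) / (2 * n) + ((n : ℝ) - α) / (2 * ((n : ℝ) - 1)) < 1)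
    (hα : α < 1)
    (c d : ℝ) (hc : 0 ≤ c) (hd : 0 < d) (y₀ : Bd n)
    (f : Bd n → ℝ)
    (hf : ∀ y, f y = c * (d ^ 2 + ‖y - y₀‖ ^ 2) ^ (-((n : ℝ) + α - 2) / 2)) :
    ∀ x' : Bd n,
      Tendsto (fun t : ℝ => t ^ (1 - α - β) * extOp n α β f (x', t))
        (nhdsWithin 0 (Set.Ioi 0))
        (nhds ((∫ y : Bd n, (1 + ‖y‖ ^ 2) ^ ((α - (n : ℝ)) / 2)) * f x')) := by
  intro x'
  have hn' : (2 : ℝ) ≤ n := by exact_mod_cast hn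
  have hm : ((n - 1 : ℕ) : ℝ) = n - 1 := by
    rw [Nat.cast_sub (by omega), Nat.cast_one]
  obtain ⟨g, hg, hbound⟩ := exists_integrable_bound_dilated_power (m := n - 1) (d := d)
    (p := (α - (n : ℝ)) / 2) (q := -((n : ℝ) + α - 2) / 2) hd
    (by rw [hm]; linarith) (by rw [hm]; linarith) x' y₀
  have hfc : Continuous f := by
    rw [funext hf]
    refine continuous_const.mul (Continuous.rpow_const (by fun_prop) fun y => Or.inl ?_)
    positivity
  have hkc : Continuous fun u : Bd n => (1 + ‖u‖ ^ 2) ^ ((α - (n : ℝ)) / 2) :=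
    Continuous.rpow_const (by fun_prop) fun u => Or.inl (by positivity)
  have hlim : Tendsto
      (fun t : ℝ => ∫ u : Bd n, f (x' - t • u) * (1 + ‖u‖ ^ 2) ^ ((α - (n : ℝ)) / 2))
      (nhdsWithin 0 (Set.Ioi 0))
      (nhds (∫ u : Bd n, f x' * (1 + ‖u‖ ^ 2) ^ ((α - (n : ℝ)) / 2))) := by
    refine tendsto_integral_filter_of_dominated_convergence (fun u => c * g u) ?_ ?_
      (hg.const_mul c) ?_
    · refine Eventually.of_forall fun t => Continuous.aestronglyMeasurable ?_
      exact (hfc.comp (by fun_prop)).mul hkc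
    · filter_upwards [Ioo_mem_nhdsGT (zero_lt_one (α := ℝ))] with t ht
      refine Eventually.of_forall fun u => ?_
      rw [hf, Real.norm_of_nonneg (by positivity), mul_assoc]
      exact mul_le_mul_of_nonneg_left (hbound t ht u) hc
    · refine Eventually.of_forall fun u => Tendsto.mul_const _ ?_
      have h : Continuous fun t : ℝ => f (x' - t • u) := hfc.comp (by fun_prop)
      simpa using (h.tendsto 0).mono_left nhdsWithin_le_nhds
  rw [integral_const_mul, mul_comm] at hlim
  refine hlim.congr' ?_
  filter_upwards [self_mem_nhdsWithin] with t ht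
  exact (rpow_mul_extOp_eq_integral (by omega) α β f x' ht).symm
end
end

section
/- Let n ≥ 2, α = 1, and suppose β ≥ 0 satisfies 0 < 1 + β < n − β and (n − 1 − 2β)/(2n) + (n − 1)/(2(n − 1)) < 1. If f(y) = c (d² + |y − y₀|²)^{−(n−1)/2} with c ≥ 0, d > 0, y₀ ∈ ∂ℝ₊ⁿ, then for every x' ∈ ℝ^{n−1}, − lim_{x_n → 0⁺} E_{1,β}f(x', x_n) / (x_n^β log x_n) = (n − 1) ω_{n−1} f(x'), where ω_{n−1} is the volume of the unit ball in ℝ^{n−1}. -/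
open MeasureTheory Real Filter Metric

noncomputable section

/-- The radial profile of the kernel differs from `1 / (r + t)` by an error whose integral over
`[0, ∞)` does not depend on `t`. -/
lemma abs_radial_kernel_sub_le (k : ℕ) {r t : ℝ} (hr : 0 ≤ r) (ht : 0 < t) :
    |r ^ k * (√(r ^ 2 + t ^ 2) ^ (k + 1))⁻¹ - (r + t)⁻¹| ≤ (k + 2) * (t / (r + t) ^ 2) := by
  set s := √(r ^ 2 + t ^ 2) with hs
  have hs2 : s ^ 2 = r ^ 2 + t ^ 2 := Real.sq_sqrt (by positivity)
  have hs0 : 0 < s := Real.sqrt_pos.2 (by positivity)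
  have hrs : r ≤ s := Real.le_sqrt_of_sq_le (by nlinarith [sq_nonneg t])
  have hsu : s ≤ r + t := by
    rw [hs, Real.sqrt_le_left (by positivity)]
    nlinarith [mul_nonneg hr ht.le]
  have hrt : 0 < r + t := by positivity
  rw [abs_le]
  constructor
  · have h1 : r ^ k * ((r + t) ^ (k + 1))⁻¹ ≤ r ^ k * (s ^ (k + 1))⁻¹ := by gcongr
    have hle : t / (r + t) ≤ 1 := by rw [div_le_one hrt]; linarith
    have h2 : 1 + (k : ℝ) * (-(t / (r + t))) ≤ (1 + -(t / (r + t))) ^ k :=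
      one_add_mul_le_pow (by linarith) k
    have h3 : 1 + -(t / (r + t)) = r / (r + t) := by field_simp; ring
    have h4 : r ^ k * ((r + t) ^ (k + 1))⁻¹ = (r / (r + t)) ^ k * (r + t)⁻¹ := by
      rw [div_pow, pow_succ]; field_simp
    rw [h3] at h2
    have h5 := mul_le_mul_of_nonneg_right h2 (inv_nonneg.2 hrt.le)
    have h6 : (1 + (k : ℝ) * (-(t / (r + t)))) * (r + t)⁻¹
        = (r + t)⁻¹ - k * (t / (r + t) ^ 2) := by field_simp; ring
    have h7 : 0 ≤ t / (r + t) ^ 2 := by positivity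
    nlinarith
  · have h1 : r ^ k * (s ^ (k + 1))⁻¹ ≤ s⁻¹ := by
      calc r ^ k * (s ^ (k + 1))⁻¹ ≤ s ^ k * (s ^ (k + 1))⁻¹ := by gcongr
        _ = s⁻¹ := by rw [pow_succ]; field_simp
    have h2 : (r + t) ^ 2 ≤ s * (r + 3 * t) := by
      apply le_of_sq_le_sq _ (by positivity)
      rw [mul_pow, hs2]
      have : 0 ≤ r * t := by positivity
      have : 0 ≤ r * t * r ^ 2 := by positivity
      have : 0 ≤ r * t * t ^ 2 := by positivity
      have : 0 ≤ t ^ 4 := by positivity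
      have : 0 ≤ r ^ 2 * t ^ 2 := by positivity
      nlinarith
    have h3 : s⁻¹ ≤ (r + t)⁻¹ + 2 * (t / (r + t) ^ 2) := by
      have : (r + t)⁻¹ + 2 * (t / (r + t) ^ 2) = (r + 3 * t) / (r + t) ^ 2 := by
        field_simp; ring
      rw [this, inv_eq_one_div, div_le_div_iff₀ hs0 (by positivity)]
      linarith
    have h7 : 0 ≤ k * (t / (r + t) ^ 2) := by positivity
    linarith

lemma abs_integral_radial_kernel_add_log_le (k : ℕ) {t : ℝ} (ht : 0 < t) (ht1 : t < 1) :
    |(∫ r in (0 : ℝ)..1, r ^ k * (√(r ^ 2 + t ^ 2) ^ (k + 1))⁻¹) + Real.log t|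
      ≤ k + 2 + Real.log 2 := by
  have hpos : ∀ r ∈ Set.uIcc (0 : ℝ) 1, 0 < r + t := fun r hr => by
    rw [Set.uIcc_of_le zero_le_one] at hr; linarith [hr.1]
  have hI0 : IntervalIntegrable (fun r : ℝ => r ^ k * (√(r ^ 2 + t ^ 2) ^ (k + 1))⁻¹)
      volume 0 1 := by
    apply Continuous.intervalIntegrable
    have : ∀ r : ℝ, √(r ^ 2 + t ^ 2) ^ (k + 1) ≠ 0 := fun r => by positivity
    fun_prop (disch := assumption)
  have hI1 : IntervalIntegrable (fun r : ℝ => (r + t)⁻¹) volume 0 1 := by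
    apply ContinuousOn.intervalIntegrable
    exact ContinuousOn.inv₀ (by fun_prop) fun r hr => (hpos r hr).ne'
  have hI2 : IntervalIntegrable (fun r : ℝ => t / (r + t) ^ 2) volume 0 1 := by
    apply ContinuousOn.intervalIntegrable
    exact ContinuousOn.div (by fun_prop) (by fun_prop) fun r hr => (pow_pos (hpos r hr) 2).ne'
  have e1 : ∫ r in (0 : ℝ)..1, (r + t)⁻¹ = Real.log (1 + t) - Real.log t := by
    rw [intervalIntegral.integral_eq_sub_of_hasDerivAt (f := fun r => Real.log (r + t)) _ hI1]
    · simp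
    · intro r hr
      simpa using ((hasDerivAt_id r).add_const t).log (hpos r hr).ne'
  have e2 : ∫ r in (0 : ℝ)..1, t / (r + t) ^ 2 = 1 - t / (1 + t) := by
    rw [intervalIntegral.integral_eq_sub_of_hasDerivAt (f := fun r => -(t * (r + t)⁻¹)) _ hI2]
    · field_simp; ring
    · intro r hr
      have := ((((hasDerivAt_id r).add_const t).inv (hpos r hr).ne').const_mul t).neg
      convert this using 1
      · ext; simp
      · simp [div_eq_mul_inv]
  have hb := intervalIntegral.norm_integral_le_of_norm_le (μ := volume) (a := 0) (b := 1)
    (f := fun r => r ^ k * (√(r ^ 2 + t ^ 2) ^ (k + 1))⁻¹ - (r + t)⁻¹)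
    (g := fun r => (k + 2) * (t / (r + t) ^ 2)) zero_le_one
    (ae_of_all _ fun r hr => abs_radial_kernel_sub_le k hr.1.le ht) (hI2.const_mul _)
  rw [intervalIntegral.integral_sub hI0 hI1, intervalIntegral.integral_const_mul, e1, e2,
    Real.norm_eq_abs] at hb
  have h1 : (k + 2) * (1 - t / (1 + t)) ≤ (k + 2 : ℝ) := by
    have : 0 ≤ t / (1 + t) := by positivity
    have hk : (0 : ℝ) ≤ k := by positivity
    nlinarith
  have h2 : 0 ≤ Real.log (1 + t) := Real.log_nonneg (by linarith)
  have h3 : Real.log (1 + t) ≤ Real.log 2 := Real.log_le_log (by linarith) (by linarith)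
  rw [abs_le] at hb ⊢
  constructor <;> linarith [hb.1, hb.2]

section Asymptotics

variable {E : Type*} [NormedAddCommGroup E] [NormedSpace ℝ E] [MeasurableSpace E] [BorelSpace E]
  [FiniteDimensional ℝ E] {k : ℕ}

lemma integral_indicator_norm_kernel (μ : Measure E) [μ.IsAddHaarMeasure]
    (hk : Module.finrank ℝ E = k + 1) (t : ℝ) :
    ∫ z : E, (closedBall (0 : E) 1).indicator
        (fun z => (√(‖z‖ ^ 2 + t ^ 2) ^ (k + 1))⁻¹) z ∂μ
      = ((k : ℝ) + 1) * μ.real (ball 0 1) *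
        ∫ r in (0 : ℝ)..1, r ^ k * (√(r ^ 2 + t ^ 2) ^ (k + 1))⁻¹ := by
  have : Nontrivial E := Module.nontrivial_of_finrank_pos (R := ℝ) (by omega)
  have h := integral_fun_norm_addHaar μ
    ((Set.Iic (1 : ℝ)).indicator fun r => (√(r ^ 2 + t ^ 2) ^ (k + 1))⁻¹)
  have h1 : (fun z : E => (Set.Iic (1 : ℝ)).indicator
      (fun r => (√(r ^ 2 + t ^ 2) ^ (k + 1))⁻¹) ‖z‖) = (closedBall (0 : E) 1).indicator
        (fun z => (√(‖z‖ ^ 2 + t ^ 2) ^ (k + 1))⁻¹) := by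
    classical ext z; simp [Set.indicator_apply]
  rw [h1] at h
  rw [h, hk, intervalIntegral.integral_of_le zero_le_one, ← Set.Ioi_inter_Iic,
    ← setIntegral_indicator measurableSet_Iic]
  simp only [nsmul_eq_mul, smul_eq_mul, Nat.add_sub_cancel, mul_assoc]
  push_cast
  congr 3
  ext r
  simp only [Set.indicator_apply]
  split_ifs <;> simp

lemma integrable_indicator_norm_mul_inv_pow (μ : Measure E) [μ.IsAddHaarMeasure]
    (hk : Module.finrank ℝ E = k + 1) :
    Integrable ((closedBall (0 : E) 1).indicator fun z => ‖z‖ * (‖z‖ ^ (k + 1))⁻¹) μ := by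
  have : Nontrivial E := Module.nontrivial_of_finrank_pos (R := ℝ) (by omega)
  have h := integrable_fun_norm_addHaar μ
    (f := (Set.Iic (1 : ℝ)).indicator fun r => r * (r ^ (k + 1))⁻¹)
  have h1 : (fun z : E => (Set.Iic (1 : ℝ)).indicator (fun r => r * (r ^ (k + 1))⁻¹) ‖z‖)
      = (closedBall (0 : E) 1).indicator fun z => ‖z‖ * (‖z‖ ^ (k + 1))⁻¹ := by
    classical ext z; simp [Set.indicator_apply]
  rw [h1] at h
  rw [h, hk]
  have h2 : Set.EqOn (fun y : ℝ => y ^ (k + 1 - 1) •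
      (Set.Iic (1 : ℝ)).indicator (fun r => r * (r ^ (k + 1))⁻¹) y)
      ((Set.Iic (1 : ℝ)).indicator fun _ => 1) (Set.Ioi 0) := by
    intro y hy
    have hy : y ≠ 0 := (Set.mem_Ioi.1 hy).ne'
    simp only [Set.indicator_apply, Nat.add_sub_cancel, smul_eq_mul]
    split_ifs
    · rw [pow_succ]; field_simp
    · simp
  rw [integrableOn_congr_fun h2 measurableSet_Ioi, IntegrableOn,
    integrable_indicator_iff measurableSet_Iic, IntegrableOn,
    Measure.restrict_restrict measurableSet_Iic, Set.inter_comm, Set.Ioi_inter_Iic]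
  exact integrableOn_const (by simp)

/-- Off the singular part of the kernel, the extension integral stays bounded as `t → 0⁺`. -/
lemma exists_abs_integral_kernel_sub_le (μ : Measure E) [μ.IsAddHaarMeasure]
    (hk : Module.finrank ℝ E = k + 1) {g : E → ℝ} (hg : Continuous g) {L C : ℝ} (hL : 0 ≤ L)
    (hlip : ∀ z, ‖z‖ ≤ 1 → |g z - g 0| ≤ L * ‖z‖)
    (hdecay : ∀ z, |g z| ≤ C * ((1 + ‖z‖) ^ (k + 1))⁻¹) :
    ∃ B, ∀ t : ℝ, 0 < t → |(∫ z, g z * (√(‖z‖ ^ 2 + t ^ 2) ^ (k + 1))⁻¹ ∂μ) -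
      g 0 * ∫ z : E, (closedBall (0 : E) 1).indicator
        (fun z => (√(‖z‖ ^ 2 + t ^ 2) ^ (k + 1))⁻¹) z ∂μ| ≤ B := by
  set G : E → ℝ := fun z =>
    L * (closedBall (0 : E) 1).indicator (fun z => ‖z‖ * (‖z‖ ^ (k + 1))⁻¹) z +
      C * 2 ^ (k + 1) * (1 + ‖z‖) ^ (-(2 * (k + 1) : ℝ)) with hG
  have hC : 0 ≤ C := by simpa using (abs_nonneg _).trans (hdecay 0)
  have hGint : Integrable G μ := by
    refine ((integrable_indicator_norm_mul_inv_pow μ hk).const_mul L).add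
      ((integrable_one_add_norm ?_).const_mul _)
    rw [hk]; push_cast; linarith [(Nat.cast_nonneg k : (0 : ℝ) ≤ k)]
  refine ⟨∫ z, G z ∂μ, fun t ht => ?_⟩
  have hne : ∀ z : E, √(‖z‖ ^ 2 + t ^ 2) ^ (k + 1) ≠ 0 := fun z => by positivity
  have hK : Continuous fun z : E => (√(‖z‖ ^ 2 + t ^ 2) ^ (k + 1))⁻¹ := by
    fun_prop (disch := assumption)
  have hind : Integrable ((closedBall (0 : E) 1).indicator
      (fun z => (√(‖z‖ ^ 2 + t ^ 2) ^ (k + 1))⁻¹)) μ := by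
    rw [integrable_indicator_iff measurableSet_closedBall]
    exact hK.continuousOn.integrableOn_compact (isCompact_closedBall 0 1)
  have hbound : ∀ z : E, ‖g z * (√(‖z‖ ^ 2 + t ^ 2) ^ (k + 1))⁻¹ -
      g 0 * (closedBall (0 : E) 1).indicator
        (fun z => (√(‖z‖ ^ 2 + t ^ 2) ^ (k + 1))⁻¹) z‖ ≤ G z := by
    intro z
    have hs : ‖z‖ ≤ √(‖z‖ ^ 2 + t ^ 2) := Real.le_sqrt_of_sq_le (by nlinarith [sq_nonneg t])
    have hz0 := norm_nonneg z
    have hKpos : 0 ≤ (√(‖z‖ ^ 2 + t ^ 2) ^ (k + 1))⁻¹ := by positivity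
    classical
    simp only [hG, Set.indicator_apply, mem_closedBall, dist_zero_right, Real.norm_eq_abs]
    split_ifs with hz
    · rw [← sub_mul, abs_mul, abs_of_nonneg hKpos]
      have h1 : |g z - g 0| * (√(‖z‖ ^ 2 + t ^ 2) ^ (k + 1))⁻¹
          ≤ L * (‖z‖ * (‖z‖ ^ (k + 1))⁻¹) := by
        rcases hz0.eq_or_lt with h0 | h0
        · have : z = 0 := norm_eq_zero.1 h0.symm
          simp [this]
        · rw [← mul_assoc]
          gcongr
          exact hlip z hz
      have : 0 ≤ C * 2 ^ (k + 1) * (1 + ‖z‖) ^ (-(2 * (k + 1) : ℝ)) := by positivity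
      linarith
    · push Not at hz
      rw [mul_zero, mul_zero, sub_zero, zero_add, abs_mul, abs_of_nonneg hKpos]
      have h1 : (1 + ‖z‖) / 2 ≤ √(‖z‖ ^ 2 + t ^ 2) := by linarith
      calc |g z| * (√(‖z‖ ^ 2 + t ^ 2) ^ (k + 1))⁻¹
          ≤ C * ((1 + ‖z‖) ^ (k + 1))⁻¹ * (((1 + ‖z‖) / 2) ^ (k + 1))⁻¹ := by
            gcongr
            exact hdecay z
        _ = C * 2 ^ (k + 1) * (1 + ‖z‖) ^ (-(2 * (k + 1) : ℝ)) := by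
            have : (1 + ‖z‖) ^ (-(2 * (k + 1) : ℝ)) = (((1 + ‖z‖) ^ (k + 1)) ^ 2)⁻¹ := by
              rw [Real.rpow_neg (by positivity), ← pow_mul, ← Real.rpow_natCast]
              push_cast
              rw [mul_comm]
            rw [this, div_pow]
            field_simp
  have hdiff : Integrable (fun z => g z * (√(‖z‖ ^ 2 + t ^ 2) ^ (k + 1))⁻¹ -
      g 0 * (closedBall (0 : E) 1).indicator
        (fun z => (√(‖z‖ ^ 2 + t ^ 2) ^ (k + 1))⁻¹) z) μ :=
    hGint.mono' (((hg.mul hK).aestronglyMeasurable).sub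
      (hind.const_mul (g 0)).aestronglyMeasurable) (ae_of_all _ hbound)
  have hfull : Integrable (fun z => g z * (√(‖z‖ ^ 2 + t ^ 2) ^ (k + 1))⁻¹) μ := by
    refine (hdiff.add (hind.const_mul (g 0))).congr (ae_of_all _ fun z => ?_)
    simp
  rw [← integral_const_mul, ← integral_sub hfull (hind.const_mul (g 0)), ← Real.norm_eq_abs]
  exact norm_integral_le_of_norm_le hGint (ae_of_all _ hbound)

theorem tendsto_integral_kernel_div_neg_log (μ : Measure E) [μ.IsAddHaarMeasure]
    (hk : Module.finrank ℝ E = k + 1) {g : E → ℝ} (hg : Continuous g) {L C : ℝ} (hL : 0 ≤ L)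
    (hlip : ∀ z, ‖z‖ ≤ 1 → |g z - g 0| ≤ L * ‖z‖)
    (hdecay : ∀ z, |g z| ≤ C * ((1 + ‖z‖) ^ (k + 1))⁻¹) :
    Tendsto (fun t : ℝ => (∫ z, g z * (√(‖z‖ ^ 2 + t ^ 2) ^ (k + 1))⁻¹ ∂μ) / -Real.log t)
      (nhdsWithin 0 (Set.Ioi 0)) (nhds (((k : ℝ) + 1) * μ.real (ball 0 1) * g 0)) := by
  obtain ⟨B, hB⟩ := exists_abs_integral_kernel_sub_le μ hk hg hL hlip hdecay
  set w := ((k : ℝ) + 1) * μ.real (ball (0 : E) 1)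
  have hlog : Tendsto (fun t : ℝ => -Real.log t) (nhdsWithin 0 (Set.Ioi 0)) atTop :=
    tendsto_neg_atBot_atTop.comp Real.tendsto_log_nhdsGT_zero
  rw [tendsto_iff_norm_sub_tendsto_zero]
  refine squeeze_zero' (Eventually.of_forall fun _ => norm_nonneg _) ?_
    (hlog.const_div_atTop (B + |g 0 * w| * (k + 2 + Real.log 2)))
  filter_upwards [Ioo_mem_nhdsGT zero_lt_one] with t ⟨ht0, ht1⟩
  have hl : 0 < -Real.log t := neg_pos.2 (Real.log_neg ht0 ht1)
  have h1 := hB t ht0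
  rw [integral_indicator_norm_kernel μ hk] at h1
  have h2 := abs_integral_radial_kernel_add_log_le k ht0 ht1
  set A := ∫ z, g z * (√(‖z‖ ^ 2 + t ^ 2) ^ (k + 1))⁻¹ ∂μ
  set I := ∫ r in (0 : ℝ)..1, r ^ k * (√(r ^ 2 + t ^ 2) ^ (k + 1))⁻¹
  have h3 : A / -Real.log t - w * g 0 =
      ((A - g 0 * (w * I)) + g 0 * w * (I + Real.log t)) / -Real.log t := by
    rw [eq_div_iff hl.ne', sub_mul, div_mul_cancel₀ _ hl.ne']
    ring
  rw [h3, Real.norm_eq_abs, abs_div, abs_of_pos hl]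
  gcongr
  refine (abs_add_le _ _).trans (add_le_add h1 ?_)
  rw [abs_mul]
  gcongr

end Asymptotics

lemma one_add_norm_le_mul_sqrt {E : Type*} [SeminormedAddCommGroup E] {d : ℝ} (hd : 0 < d)
    (a z : E) : 1 + ‖z‖ ≤ (1 + (1 + ‖a‖) / d) * √(d ^ 2 + ‖a + z‖ ^ 2) := by
  have h1 : d ≤ √(d ^ 2 + ‖a + z‖ ^ 2) := Real.le_sqrt_of_sq_le (by nlinarith [sq_nonneg ‖a + z‖])
  have h2 : ‖a + z‖ ≤ √(d ^ 2 + ‖a + z‖ ^ 2) := Real.le_sqrt_of_sq_le (by nlinarith [sq_nonneg d])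
  have h3 : ‖z‖ ≤ ‖a + z‖ + ‖a‖ := by simpa using norm_sub_le (a + z) a
  have h4 : (1 + ‖a‖) / d * d ≤ (1 + ‖a‖) / d * √(d ^ 2 + ‖a + z‖ ^ 2) := by gcongr
  rw [div_mul_cancel₀ _ hd.ne'] at h4
  linarith

lemma contDiff_inv_sqrt_pow {E : Type*} [NormedAddCommGroup E] [InnerProductSpace ℝ E] {d : ℝ}
    (hd : 0 < d) (a : E) (k : ℕ) :
    ContDiff ℝ 1 fun z : E => (√(d ^ 2 + ‖a + z‖ ^ 2) ^ k)⁻¹ := by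
  have h0 : ∀ z : E, d ^ 2 + ‖a + z‖ ^ 2 ≠ 0 := fun z => by positivity
  have h1 : ContDiff ℝ 1 fun z : E => d ^ 2 + ‖a + z‖ ^ 2 :=
    contDiff_const.add ((contDiff_const.add contDiff_id).norm_sq ℝ)
  exact ((h1.sqrt h0).pow k).inv fun z => by positivity

/-- **Boundary behaviour of the extension of the extremal functions, case `α = 1`**:
for `f(y) = c (d² + |y - y₀|²)^{-(n-1)/2}` one has
`-lim_{xₙ → 0⁺} E_{1,β}f(x', xₙ)/(xₙ^β log xₙ) = (n-1) ω_{n-1} f(x')`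
for every `x' ∈ ∂ℝⁿ₊`, where `ω_{n-1}` is the volume of the unit ball of `ℝ^{n-1}`. -/
theorem extension_boundary_limit_alpha_eq_one
    (n : ℕ) (hn : 2 ≤ n) (β : ℝ)
    (hβ : 0 ≤ β) (hαβ : 0 < 1 + β) (hαβn : 1 + β < (n : ℝ) - β)
    (hsub : ((n : ℝ) - 1 - 2 * β) / (2 * n) + ((n : ℝ) - 1) / (2 * ((n : ℝ) - 1)) < 1)
    (c d : ℝ) (hc : 0 ≤ c) (hd : 0 < d) (y₀ : Bd n)
    (f : Bd n → ℝ)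
    (hf : ∀ y, f y = c * (d ^ 2 + ‖y - y₀‖ ^ 2) ^ (-((n : ℝ) - 1) / 2)) :
    ∀ x' : Bd n,
      Tendsto (fun t : ℝ => -(extOp n 1 β f (x', t) / (t ^ β * Real.log t)))
        (nhdsWithin 0 (Set.Ioi 0))
        (nhds (((n : ℝ) - 1) *
          (volume (Metric.ball (0 : Bd n) 1)).toReal * f x')) := by
  intro x'
  obtain ⟨k, rfl⟩ : ∃ k, n = k + 2 := ⟨n - 2, by omega⟩
  have hdim : Module.finrank ℝ (Bd (k + 2)) = k + 1 := by simp
  set g : Bd (k + 2) → ℝ := fun z => c * (√(d ^ 2 + ‖(x' - y₀) + z‖ ^ 2) ^ (k + 1))⁻¹ with hg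
  have hfg : ∀ z, f (x' + z) = g z := fun z => by
    rw [hf, hg, add_sub_right_comm]
    have h0 : 0 ≤ d ^ 2 + ‖(x' - y₀) + z‖ ^ 2 := by positivity
    dsimp only
    rw [Real.sqrt_eq_rpow, ← Real.rpow_natCast _ (k + 1), ← Real.rpow_mul h0, ← Real.rpow_neg h0]
    congr 2
    push_cast
    ring
  have hcd : ContDiff ℝ 1 g := contDiff_const.mul (contDiff_inv_sqrt_pow hd _ _)
  obtain ⟨L, hL⟩ := hcd.contDiffOn.exists_lipschitzOnWith one_ne_zero
    (convex_closedBall (0 : Bd (k + 2)) 1) (isCompact_closedBall 0 1)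
  have hlip : ∀ z, ‖z‖ ≤ 1 → |g z - g 0| ≤ L * ‖z‖ := fun z hz => by
    simpa [Real.dist_eq] using hL.dist_le_mul z (by simpa using hz) 0 (by simp)
  have hdecay : ∀ z, |g z| ≤
      c * (1 + (1 + ‖x' - y₀‖) / d) ^ (k + 1) * ((1 + ‖z‖) ^ (k + 1))⁻¹ := fun z => by
    have h1 := pow_le_pow_left₀ (by positivity) (one_add_norm_le_mul_sqrt hd (x' - y₀) z) (k + 1)
    rw [mul_pow] at h1
    rw [abs_of_nonneg (by positivity), mul_assoc]
    refine mul_le_mul_of_nonneg_left ?_ hc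
    rw [inv_eq_one_div, ← div_eq_mul_inv, div_le_div_iff₀ (by positivity) (by positivity)]
    linarith
  have key := tendsto_integral_kernel_div_neg_log (volume : Measure (Bd (k + 2))) hdim
    hcd.continuous L.coe_nonneg hlip hdecay
  have hlim : (((k + 2 : ℕ) : ℝ) - 1) * (volume (ball (0 : Bd (k + 2)) 1)).toReal * f x' =
      ((k : ℝ) + 1) * (volume : Measure (Bd (k + 2))).real (ball 0 1) * g 0 := by
    rw [← hfg, add_zero, Measure.real]
    push_cast
    ring
  rw [hlim]
  refine key.congr' ?_
  filter_upwards [self_mem_nhdsWithin] with t ht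
  have ht : 0 < t := ht
  have hext : extOp (k + 2) 1 β f (x', t) =
      t ^ β * ∫ z, g z * (√(‖z‖ ^ 2 + t ^ 2) ^ (k + 1))⁻¹ := by
    rw [extOp, ← integral_const_mul, ← integral_add_left_eq_self _ x']
    congr 1
    ext z
    simp only [kern, hfg, sub_add_cancel_left, norm_neg]
    rw [mul_assoc, ← Real.rpow_natCast _ (k + 1), ← Real.rpow_neg (Real.sqrt_nonneg _)]
    congr 3
    push_cast
    ring
  rw [hext, mul_div_mul_left _ _ (Real.rpow_pos_of_pos ht β).ne', div_neg]
end
end
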